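/- Let 𝓗 be an infinite-dimensional complex Hilbert space. Then 𝓡_f(𝓗) (the closable elements of 𝓥_f(𝓗)) and 𝓢_f(𝓗) (the singular elements of 𝓥_f(𝓗)) are sub-generalized effect algebras of the generalized effect algebra (𝓥_f(𝓗); ⊕̄, o); in particular, if t, u ∈ 𝓡_f(𝓗) and s ∈ 𝓥_f(𝓗) satisfy t ⊕̄ s = u, then s ∈ 𝓡_f(𝓗), and the analogous statement holds for 𝓢_f(𝓗). -/

import Mathlib

set_option autoImplicit false

noncomputable section

open Filter

variable {H : Type*}

/-- A densely defined positive bilinear (sesquilinear) form on a complex Hilbert space `H`: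
it is given by a dense domain `dom` and a map `toFun : H → H → ℂ` which is linear in the
first argument and conjugate-linear in the second one on the domain, takes real nonnegative
values on the diagonal of the domain, and (as a normalization) vanishes off the domain. -/
structure PBF (H : Type*) [NormedAddCommGroup H] [InnerProductSpace ℂ H] where
  dom : Submodule ℂ H
  dense' : Dense (dom : Set H)
  toFun : H → H → ℂ
  zero_off : ∀ x y : H, x ∉ dom ∨ y ∉ dom → toFun x y = 0
  add_left : ∀ x y z : H, x ∈ dom → y ∈ dom → z ∈ dom →
    toFun (x + y) z = toFun x z + toFun y z
  smul_left : ∀ (c : ℂ) (x y : H), x ∈ dom → y ∈ dom →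
    toFun (c • x) y = c * toFun x y
  add_right : ∀ x y z : H, x ∈ dom → y ∈ dom → z ∈ dom →
    toFun x (y + z) = toFun x y + toFun x z
  smul_right : ∀ (c : ℂ) (x y : H), x ∈ dom → y ∈ dom →
    toFun x (c • y) = (starRingEnd ℂ) c * toFun x y
  re_nonneg : ∀ x : H, x ∈ dom → 0 ≤ (toFun x x).re
  im_zero : ∀ x : H, x ∈ dom → (toFun x x).im = 0

variable [NormedAddCommGroup H] [InnerProductSpace ℂ H]

namespace PBF

/-- A positive bilinear form is bounded if `sup {t(x,x) : x ∈ D(t), ‖x‖ = 1} < ∞`. -/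
def Bounded (t : PBF H) : Prop :=
  ∃ c : ℝ, ∀ x ∈ t.dom, (t.toFun x x).re ≤ c * ‖x‖ ^ 2

/-- Membership in `𝓥_f(𝓗)`: a positive bilinear form whose domain is all of `H`
whenever the form is bounded. -/
def InVf (t : PBF H) : Prop := t.Bounded → t.dom = ⊤

/-- `u` is the usual sum `t + s`, with domain `D(t) ⊓ D(s)`. -/
def IsSum (t s u : PBF H) : Prop :=
  u.dom = t.dom ⊓ s.dom ∧
  ∀ x y : H, x ∈ u.dom → y ∈ u.dom → u.toFun x y = t.toFun x y + s.toFun x y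

/-- Definedness of the partial operation `⊕` on `𝓥_f(𝓗)`:
`t ⊕ s` is defined iff `t` or `s` is bounded, or `D(t) = D(s)`. -/
def OplusDef (t s : PBF H) : Prop := t.Bounded ∨ s.Bounded ∨ t.dom = s.dom

/-- `t ⊕ s = u` in `𝓥_f(𝓗)`. -/
def Oplus (t s u : PBF H) : Prop := OplusDef t s ∧ IsSum t s u

/-- The squared norm `‖x‖_t² = t(x,x) + ‖x‖²` associated with the inner product
`(x,y)_t := t(x,y) + (x,y)` on `D(t)`. -/
def q (t : PBF H) (x : H) : ℝ := (t.toFun x x).re + ‖x‖ ^ 2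

/-- `t` is closed: `D(t)` is complete under the inner product `(x,y)_t := t(x,y) + (x,y)`
(sequential formulation of completeness). -/
def IsClosedForm (t : PBF H) : Prop :=
  ∀ f : ℕ → H, (∀ n, f n ∈ t.dom) →
    (∀ ε : ℝ, 0 < ε → ∃ N : ℕ, ∀ m ≥ N, ∀ n ≥ N, t.q (f m - f n) < ε) →
    ∃ x ∈ t.dom, Tendsto (fun n => t.q (f n - x)) atTop (nhds 0)

/-- `s` is an extension of `t` (i.e. `s|_{D(t)} = t`). -/
def Extends (s t : PBF H) : Prop :=
  t.dom ≤ s.dom ∧ ∀ x y : H, x ∈ t.dom → y ∈ t.dom → s.toFun x y = t.toFun x y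

/-- `t` is closable (equivalently, regular) iff it has a closed extension. -/
def Closable (t : PBF H) : Prop := ∃ s : PBF H, s.IsClosedForm ∧ s.Extends t

/-- `t` is singular: the only closable positive bilinear form `r` with `D(r) = D(t)` and
`r(x,x) ≤ t(x,x)` on `D(t)` is the zero form. -/
def Singular (t : PBF H) : Prop :=
  ∀ r : PBF H, r.Closable → r.dom = t.dom →
    (∀ x ∈ t.dom, (r.toFun x x).re ≤ (t.toFun x x).re) →
    ∀ x y : H, r.toFun x y = 0

/-- `tr` is the regular part of `t`: the largest closable positive bilinear form `r` with
`D(r) = D(t)` and `r(x,x) ≤ t(x,x)` for all `x ∈ D(t)` (Simon's decomposition theorem). -/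
def IsRegularPart (t tr : PBF H) : Prop :=
  tr.Closable ∧ tr.dom = t.dom ∧
  (∀ x ∈ t.dom, (tr.toFun x x).re ≤ (t.toFun x x).re) ∧
  ∀ r : PBF H, r.Closable → r.dom = t.dom →
    (∀ x ∈ t.dom, (r.toFun x x).re ≤ (t.toFun x x).re) →
    ∀ x ∈ t.dom, (r.toFun x x).re ≤ (tr.toFun x x).re

end PBF

/-- The zero form `o`, with `D(o) = 𝓗`. -/
def zeroPBF (H : Type*) [NormedAddCommGroup H] [InnerProductSpace ℂ H] : PBF H where
  dom := ⊤
  dense' := by rw [Submodule.top_coe]; exact dense_univ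
  toFun := fun _ _ => 0
  zero_off := fun _ _ _ => rfl
  add_left := by intros; simp
  smul_left := by intros; simp
  add_right := by intros; simp
  smul_right := by intros; simp
  re_nonneg := by intros; simp
  im_zero := by intros; simp

/-- `Q` is (the carrier of) a sub-generalized effect algebra of `(𝓥_f(𝓗); ⊕, o)`:
it contains `o`, and whenever `x ⊕ y = z` in `𝓥_f(𝓗)` with at least two of `x, y, z`
in `Q`, then all three are in `Q`. -/
def SubGEACond (Q : PBF H → Prop) : Prop :=
  Q (zeroPBF H) ∧
  ∀ x y z : PBF H, x.InVf → y.InVf → z.InVf → PBF.Oplus x y z →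
    ((Q x ∧ Q y) ∨ (Q x ∧ Q z) ∨ (Q y ∧ Q z)) → (Q x ∧ Q y ∧ Q z)

/-- Membership in the generalized effect algebra carried by `{t ∈ 𝓥_f(𝓗) : Q t}`. -/
def MemAlg (Q : PBF H → Prop) (t : PBF H) : Prop := t.InVf ∧ Q t

/-- The order induced by the restricted operation `⊕|_Q` on `{t ∈ 𝓥_f(𝓗) : Q t}`:
`s ≤ t` iff `s ⊕ r = t` for some `r` in the algebra. -/
def leQ (Q : PBF H → Prop) (s t : PBF H) : Prop :=
  ∃ r : PBF H, MemAlg Q r ∧ PBF.Oplus s r t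

/-- The order induced by `⊕` on `𝓥_f(𝓗)`: `s ≤ t` iff `s ⊕ r = t` for some `r ∈ 𝓥_f(𝓗)`. -/
def leVf (s t : PBF H) : Prop := ∃ r : PBF H, r.InVf ∧ PBF.Oplus s r t

/-- The algebra `{t ∈ 𝓥_f(𝓗) : Q t}` is monotone Dedekind upwards σ-complete: every
non-decreasing sequence dominated by some element has a supremum (w.r.t. the induced order). -/
def UpSigmaQ (Q : PBF H → Prop) : Prop :=
  ∀ f : ℕ → PBF H, (∀ n, MemAlg Q (f n)) → (∀ n, leQ Q (f n) (f (n + 1))) →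
    (∃ b : PBF H, MemAlg Q b ∧ ∀ n, leQ Q (f n) b) →
    ∃ s : PBF H, MemAlg Q s ∧ (∀ n, leQ Q (f n) s) ∧
      ∀ z : PBF H, MemAlg Q z → (∀ n, leQ Q (f n) z) → leQ Q s z

/-- The algebra `{t ∈ 𝓥_f(𝓗) : Q t}` is monotone Dedekind downwards σ-complete: every
non-increasing sequence has an infimum (w.r.t. the induced order). -/
def DownSigmaQ (Q : PBF H → Prop) : Prop :=
  ∀ f : ℕ → PBF H, (∀ n, MemAlg Q (f n)) → (∀ n, leQ Q (f (n + 1)) (f n)) →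
    ∃ i : PBF H, MemAlg Q i ∧ (∀ n, leQ Q i (f n)) ∧
      ∀ z : PBF H, MemAlg Q z → (∀ n, leQ Q z (f n)) → leQ Q z i

/-- Definedness of the restricted operation `⊕̄` on `𝓥_f(𝓗)`: `t ⊕̄ s` is defined iff
`t ⊕ s` is defined and `(t+s)_r = t_r + s_r` (the regular parts add up). -/
def ObarDef (t s : PBF H) : Prop :=
  PBF.OplusDef t s ∧
  ∀ u tr sr ur : PBF H, PBF.IsSum t s u →
    t.IsRegularPart tr → s.IsRegularPart sr → u.IsRegularPart ur →
    PBF.IsSum tr sr ur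

/-- `t ⊕̄ s = u`. -/
def Obar (t s u : PBF H) : Prop := ObarDef t s ∧ PBF.IsSum t s u

/-- The order induced by `⊕̄` on `𝓥_f(𝓗)`. -/
def leBar (s t : PBF H) : Prop := ∃ r : PBF H, r.InVf ∧ Obar s r t

/-- `Q` is (the carrier of) a sub-generalized effect algebra of `(𝓥_f(𝓗); ⊕̄, o)`. -/
def SubGEACondBar {H : Type*} [NormedAddCommGroup H] [InnerProductSpace ℂ H]
    (Q : PBF H → Prop) : Prop :=
  Q (zeroPBF H) ∧
  ∀ x y z : PBF H, x.InVf → y.InVf → z.InVf → Obar x y z →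
    ((Q x ∧ Q y) ∨ (Q x ∧ Q z) ∨ (Q y ∧ Q z)) → (Q x ∧ Q y ∧ Q z)

open scoped Topology

namespace PBF

variable {K : Type*} [NormedAddCommGroup K] [InnerProductSpace ℂ K]

theorem conj_symm (t : PBF H) {x y : H} (hx : x ∈ t.dom) (hy : y ∈ t.dom) :
    (starRingEnd ℂ) (t.toFun y x) = t.toFun x y := by
  have hIy : Complex.I • y ∈ t.dom := t.dom.smul_mem _ hy
  have h1 := t.im_zero _ (t.dom.add_mem hx hy)
  have h2 := t.im_zero _ (t.dom.add_mem hx hIy)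
  have h3 := t.im_zero _ hx
  have h4 := t.im_zero _ hy
  rw [t.add_left _ _ _ hx hy (t.dom.add_mem hx hy), t.add_right _ _ _ hx hx hy,
    t.add_right _ _ _ hy hx hy] at h1
  rw [t.add_left _ _ _ hx hIy (t.dom.add_mem hx hIy), t.add_right _ _ _ hx hx hIy,
    t.add_right _ _ _ hIy hx hIy, t.smul_left _ _ _ hy hx, t.smul_left _ _ _ hy hIy,
    t.smul_right _ _ _ hy hy, t.smul_right _ _ _ hx hy] at h2
  simp at h1 h2
  apply Complex.ext
  · simp; linarith
  · simp; linarith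

theorem toFun_eq_zero_of_diag (t : PBF H) (h : ∀ x ∈ t.dom, (t.toFun x x).re = 0) (x y : H) :
    t.toFun x y = 0 := by
  by_cases hxy : x ∈ t.dom ∧ y ∈ t.dom
  · obtain ⟨hx, hy⟩ := hxy
    have hIy : Complex.I • y ∈ t.dom := t.dom.smul_mem _ hy
    have h1 := h _ (t.dom.add_mem hx hy)
    have h2 := h _ (t.dom.add_mem hx hIy)
    have h3 := h _ hx
    have h4 := h _ hy
    have h5 := t.conj_symm hx hy
    rw [t.add_left _ _ _ hx hy (t.dom.add_mem hx hy), t.add_right _ _ _ hx hx hy,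
      t.add_right _ _ _ hy hx hy, ← h5] at h1
    rw [t.add_left _ _ _ hx hIy (t.dom.add_mem hx hIy), t.add_right _ _ _ hx hx hIy,
      t.add_right _ _ _ hIy hx hIy, t.smul_left _ _ _ hy hx, t.smul_left _ _ _ hy hIy,
      t.smul_right _ _ _ hy hy, t.smul_right _ _ _ hx hy, ← h5] at h2
    simp at h1 h2
    rw [← h5]
    apply Complex.ext
    · simp; linarith
    · simp; linarith
  · exact t.zero_off x y (by tauto)

/-- The domain of `t`, to be normed by `(x,y)_t = t(x,y) + (x,y)`. -/
def FormSpace (t : PBF H) : Type _ := t.dom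

instance (t : PBF H) : AddCommGroup t.FormSpace := inferInstanceAs (AddCommGroup t.dom)

instance (t : PBF H) : Module ℂ t.FormSpace := inferInstanceAs (Module ℂ t.dom)

/-- The inclusion of the form domain into `H`. -/
def incl (t : PBF H) : t.FormSpace →ₗ[ℂ] H := t.dom.subtype

theorem incl_mem (t : PBF H) (x : t.FormSpace) : t.incl x ∈ t.dom := x.2

theorem exists_incl_eq (t : PBF H) {x : H} (hx : x ∈ t.dom) : ∃ a : t.FormSpace, t.incl a = x :=
  ⟨⟨x, hx⟩, rfl⟩

theorem incl_injective (t : PBF H) : Function.Injective t.incl := t.dom.injective_subtype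

/-- The inner product `(x,y)_t = t(x,y) + (x,y)` on the domain of `t`. -/
@[reducible]
def formCore (t : PBF H) : InnerProductSpace.Core ℂ t.FormSpace where
  inner x y := t.toFun (t.incl y) (t.incl x) + inner ℂ (t.incl x) (t.incl y)
  conj_inner_symm x y := by
    rw [map_add, inner_conj_symm, t.conj_symm (t.incl_mem _) (t.incl_mem _)]
  re_inner_nonneg x := by
    have h1 := t.re_nonneg _ (t.incl_mem x)
    have h2 := inner_self_nonneg (𝕜 := ℂ) (x := t.incl x)
    simp only [map_add]
    exact add_nonneg h1 h2
  add_left x y z := by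
    rw [map_add, t.add_right _ _ _ (t.incl_mem _) (t.incl_mem _) (t.incl_mem _), inner_add_left]
    ring
  smul_left x y r := by
    rw [map_smul, t.smul_right _ _ _ (t.incl_mem _) (t.incl_mem _), inner_smul_left]
    ring
  definite x hx := by
    have h1 := t.re_nonneg _ (t.incl_mem x)
    have h2 := congrArg Complex.re hx
    rw [Complex.add_re, inner_self_eq_norm_sq_to_K] at h2
    have h3 : ((((‖t.incl x‖ : ℝ) : ℂ)) ^ 2).re = ‖t.incl x‖ ^ 2 := by
      rw [← Complex.ofReal_pow, Complex.ofReal_re]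
    have h4 : (t.toFun (t.incl x) (t.incl x)).re + ‖t.incl x‖ ^ 2 = 0 := by
      rw [← h3]; exact h2
    have h5 : ‖t.incl x‖ = 0 := by nlinarith [sq_nonneg ‖t.incl x‖]
    apply t.incl_injective
    rw [map_zero, norm_eq_zero.mp h5]

instance (t : PBF H) : NormedAddCommGroup t.FormSpace :=
  t.formCore.toNormedAddCommGroup

instance (t : PBF H) : InnerProductSpace ℂ t.FormSpace :=
  InnerProductSpace.ofCore t.formCore.toCore

theorem inner_formSpace (t : PBF H) (x y : t.FormSpace) :
    inner ℂ x y = t.toFun (t.incl y) (t.incl x) + inner ℂ (t.incl x) (t.incl y) := rfl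

theorem re_inner_self (x : H) : (inner ℂ x x : ℂ).re = ‖x‖ ^ 2 :=
  (norm_sq_eq_re_inner (𝕜 := ℂ) x).symm

theorem norm_sq_formSpace (t : PBF H) (x : t.FormSpace) : ‖x‖ ^ 2 = t.q (t.incl x) := by
  rw [← re_inner_self x, inner_formSpace, Complex.add_re, re_inner_self, q]

theorem q_nonneg (t : PBF H) {x : H} (hx : x ∈ t.dom) : 0 ≤ t.q x :=
  add_nonneg (t.re_nonneg x hx) (sq_nonneg _)

theorem norm_sq_le_q (t : PBF H) {x : H} (hx : x ∈ t.dom) : ‖x‖ ^ 2 ≤ t.q x :=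
  le_add_of_nonneg_left (t.re_nonneg x hx)

theorem norm_formSpace (t : PBF H) (x : t.FormSpace) : ‖x‖ = √(t.q (t.incl x)) := by
  rw [← norm_sq_formSpace, Real.sqrt_sq (norm_nonneg _)]

theorem norm_incl_le (t : PBF H) (x : t.FormSpace) : ‖t.incl x‖ ≤ ‖x‖ := by
  have := t.norm_sq_le_q (t.incl_mem x)
  rw [← norm_sq_formSpace] at this
  exact le_of_sq_le_sq this (norm_nonneg _)

theorem sqrt_q_add_le (t : PBF H) {x y : H} (hx : x ∈ t.dom) (hy : y ∈ t.dom) :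
    √(t.q (x + y)) ≤ √(t.q x) + √(t.q y) := by
  obtain ⟨a, rfl⟩ := t.exists_incl_eq hx
  obtain ⟨b, rfl⟩ := t.exists_incl_eq hy
  rw [← map_add, ← norm_formSpace, ← norm_formSpace, ← norm_formSpace]
  exact norm_add_le a b

open Classical in
/-- The form `(A x, A y) - (x, y)` on `D`, for a linear map `A` which does not decrease norms. -/
def ofLinear (D : Submodule ℂ H) (hD : Dense (D : Set H)) (A : D →ₗ[ℂ] K)
    (hA : ∀ x : D, ‖(x : H)‖ ≤ ‖A x‖) : PBF H where
  dom := D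
  dense' := hD
  toFun x y := if h : x ∈ D ∧ y ∈ D then
    inner ℂ (A ⟨y, h.2⟩) (A ⟨x, h.1⟩) - inner ℂ y x else 0
  zero_off x y h := dif_neg (by tauto)
  add_left x y z hx hy hz := by
    have e : (⟨x + y, D.add_mem hx hy⟩ : D) = ⟨x, hx⟩ + ⟨y, hy⟩ := rfl
    simp only [hx, hy, hz, D.add_mem hx hy, and_self, dite_true, e, map_add, inner_add_right]
    ring
  smul_left c x y hx hy := by
    have e : (⟨c • x, D.smul_mem c hx⟩ : D) = c • ⟨x, hx⟩ := rfl
    simp only [hx, hy, D.smul_mem c hx, and_self, dite_true, e, map_smul, inner_smul_right]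
    ring
  add_right x y z hx hy hz := by
    have e : (⟨y + z, D.add_mem hy hz⟩ : D) = ⟨y, hy⟩ + ⟨z, hz⟩ := rfl
    simp only [hx, hy, hz, D.add_mem hy hz, and_self, dite_true, e, map_add, inner_add_left]
    ring
  smul_right c x y hx hy := by
    have e : (⟨c • y, D.smul_mem c hy⟩ : D) = c • ⟨y, hy⟩ := rfl
    simp only [hx, hy, D.smul_mem c hy, and_self, dite_true, e, map_smul, inner_smul_left]
    ring
  re_nonneg x hx := by
    have := pow_le_pow_left₀ (norm_nonneg _) (hA ⟨x, hx⟩) 2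
    simp only [hx, and_self, dite_true, Complex.sub_re, re_inner_self]
    linarith
  im_zero x hx := by
    simp only [hx, and_self, dite_true, Complex.sub_im]
    rw [inner_self_eq_norm_sq_to_K, inner_self_eq_norm_sq_to_K]
    simp [← Complex.ofReal_pow]

section ofLinear

variable {D : Submodule ℂ H} {hD : Dense (D : Set H)} {A : D →ₗ[ℂ] K}
  {hA : ∀ x : D, ‖(x : H)‖ ≤ ‖A x‖}

theorem ofLinear_apply {x y : H} (hx : x ∈ D) (hy : y ∈ D) :
    (ofLinear D hD A hA).toFun x y = inner ℂ (A ⟨y, hy⟩) (A ⟨x, hx⟩) - inner ℂ y x :=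
  dif_pos ⟨hx, hy⟩

theorem q_ofLinear {x : H} (hx : x ∈ D) : (ofLinear D hD A hA).q x = ‖A ⟨x, hx⟩‖ ^ 2 := by
  rw [q, ofLinear_apply hx hx, Complex.sub_re, re_inner_self, re_inner_self]
  ring

theorem isClosedForm_ofLinear [CompleteSpace K] (hsurj : Function.Surjective A) :
    (ofLinear D hD A hA).IsClosedForm := by
  intro f hf hc
  have hf' : ∀ n, f n ∈ D := hf
  have hq : ∀ n (b : D), (ofLinear D hD A hA).q (f n - b) = ‖A ⟨f n, hf' n⟩ - A b‖ ^ 2 := by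
    intro n b
    rw [q_ofLinear (D.sub_mem (hf' n) b.2), ← map_sub]
    rfl
  have hcau : CauchySeq (fun n => A ⟨f n, hf' n⟩) := by
    rw [Metric.cauchySeq_iff]
    intro ε hε
    obtain ⟨N, hN⟩ := hc (ε ^ 2) (by positivity)
    refine ⟨N, fun m hm n hn => ?_⟩
    have := hN m hm n hn
    rw [hq m ⟨f n, hf' n⟩] at this
    rw [dist_eq_norm]
    exact lt_of_pow_lt_pow_left₀ 2 hε.le this
  obtain ⟨a, ha⟩ := cauchySeq_tendsto_of_complete hcau
  obtain ⟨x, rfl⟩ := hsurj a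
  refine ⟨x, x.2, ?_⟩
  simp only [hq _ x]
  have := (tendsto_iff_norm_sub_tendsto_zero.mp ha).pow 2
  simpa using this

end ofLinear

theorem isClosedForm_of_bounded [CompleteSpace H] {t : PBF H} (ht : t.Bounded) (hd : t.dom = ⊤) :
    t.IsClosedForm := by
  obtain ⟨c, hc⟩ := ht
  have hm : ∀ x, x ∈ t.dom := fun x => hd ▸ Submodule.mem_top
  intro f _ hcau
  have hcau' : CauchySeq f := by
    rw [Metric.cauchySeq_iff]
    intro ε hε
    obtain ⟨N, hN⟩ := hcau (ε ^ 2) (by positivity)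
    refine ⟨N, fun m hm' n hn => ?_⟩
    rw [dist_eq_norm]
    exact lt_of_pow_lt_pow_left₀ 2 hε.le ((t.norm_sq_le_q (hm _)).trans_lt (hN m hm' n hn))
  obtain ⟨x, hx⟩ := cauchySeq_tendsto_of_complete hcau'
  refine ⟨x, hm x, ?_⟩
  have h := ((tendsto_iff_norm_sub_tendsto_zero.mp hx).pow 2).const_mul (c + 1)
  refine squeeze_zero (fun n => t.q_nonneg (hm _)) (fun n => ?_) (by simpa using h)
  have := hc _ (hm (f n - x))
  rw [q]
  linarith

theorem extends_refl (t : PBF H) : t.Extends t := ⟨le_rfl, fun _ _ _ _ => rfl⟩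

theorem Extends.q_eq {s t : PBF H} (h : s.Extends t) {x : H} (hx : x ∈ t.dom) :
    s.q x = t.q x := by
  rw [q, q, h.2 x x hx hx]

theorem closable_of_bounded [CompleteSpace H] {t : PBF H} (ht : t.Bounded) (hd : t.dom = ⊤) :
    t.Closable :=
  ⟨t, isClosedForm_of_bounded ht hd, t.extends_refl⟩

theorem bounded_zeroPBF : (zeroPBF H).Bounded := ⟨0, fun x _ => by simp [zeroPBF]⟩

theorem closable_zeroPBF [CompleteSpace H] : (zeroPBF H).Closable :=
  closable_of_bounded bounded_zeroPBF rfl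

open Classical in
/-- The sum of two forms whose domains have a dense intersection. -/
def add (s t : PBF H) (h : Dense ((s.dom ⊓ t.dom : Submodule ℂ H) : Set H)) : PBF H where
  dom := s.dom ⊓ t.dom
  dense' := h
  toFun x y := if x ∈ s.dom ⊓ t.dom ∧ y ∈ s.dom ⊓ t.dom then s.toFun x y + t.toFun x y else 0
  zero_off x y h := if_neg (by tauto)
  add_left x y z hx hy hz := by
    rw [if_pos ⟨Submodule.add_mem _ hx hy, hz⟩, if_pos ⟨hx, hz⟩, if_pos ⟨hy, hz⟩,
      s.add_left _ _ _ hx.1 hy.1 hz.1, t.add_left _ _ _ hx.2 hy.2 hz.2]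
    ring
  smul_left c x y hx hy := by
    rw [if_pos ⟨Submodule.smul_mem _ c hx, hy⟩, if_pos ⟨hx, hy⟩,
      s.smul_left _ _ _ hx.1 hy.1, t.smul_left _ _ _ hx.2 hy.2]
    ring
  add_right x y z hx hy hz := by
    rw [if_pos ⟨hx, Submodule.add_mem _ hy hz⟩, if_pos ⟨hx, hy⟩, if_pos ⟨hx, hz⟩,
      s.add_right _ _ _ hx.1 hy.1 hz.1, t.add_right _ _ _ hx.2 hy.2 hz.2]
    ring
  smul_right c x y hx hy := by
    rw [if_pos ⟨hx, Submodule.smul_mem _ c hy⟩, if_pos ⟨hx, hy⟩,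
      s.smul_right _ _ _ hx.1 hy.1, t.smul_right _ _ _ hx.2 hy.2]
    ring
  re_nonneg x hx := by
    rw [if_pos ⟨hx, hx⟩, Complex.add_re]
    exact add_nonneg (s.re_nonneg x hx.1) (t.re_nonneg x hx.2)
  im_zero x hx := by
    rw [if_pos ⟨hx, hx⟩, Complex.add_im, s.im_zero x hx.1, t.im_zero x hx.2, add_zero]

theorem isSum_add (s t : PBF H) (h : Dense ((s.dom ⊓ t.dom : Submodule ℂ H) : Set H)) :
    IsSum s t (s.add t h) :=
  ⟨rfl, fun _ _ hx hy => if_pos ⟨hx, hy⟩⟩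

theorem IsSum.comm {s t u : PBF H} (h : IsSum s t u) : IsSum t s u :=
  ⟨h.1.trans (inf_comm _ _), fun x y hx hy => (h.2 x y hx hy).trans (add_comm _ _)⟩

theorem IsSum.q_add {s t u : PBF H} (h : IsSum s t u) {x : H} (hx : x ∈ u.dom) :
    u.q x + ‖x‖ ^ 2 = s.q x + t.q x := by
  rw [q, q, q, h.2 x x hx hx, Complex.add_re]
  ring

theorem tendsto_of_tendsto_q {t : PBF H} {f : ℕ → H} {x : H} (hf : ∀ n, f n ∈ t.dom)
    (hx : x ∈ t.dom) (h : Tendsto (fun n => t.q (f n - x)) atTop (𝓝 0)) :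
    Tendsto f atTop (𝓝 x) := by
  rw [tendsto_iff_norm_sub_tendsto_zero]
  have h2 := (Real.continuous_sqrt.tendsto 0).comp h
  rw [Real.sqrt_zero] at h2
  refine squeeze_zero (fun n => norm_nonneg _) (fun n => ?_) h2
  exact Real.le_sqrt_of_sq_le (t.norm_sq_le_q (t.dom.sub_mem (hf n) hx))

theorem IsSum.isClosedForm {s t u : PBF H} (h : IsSum s t u) (hs : s.IsClosedForm)
    (ht : t.IsClosedForm) : u.IsClosedForm := by
  intro f hf hcau
  have hdom : ∀ x, x ∈ u.dom ↔ x ∈ s.dom ∧ x ∈ t.dom := fun x => by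
    rw [h.1, Submodule.mem_inf]
  have hle_s : ∀ x ∈ u.dom, s.q x ≤ u.q x := fun x hx => by
    have h1 := h.q_add hx
    have h2 := t.norm_sq_le_q ((hdom x).1 hx).2
    linarith
  have hle_t : ∀ x ∈ u.dom, t.q x ≤ u.q x := fun x hx => by
    have h1 := h.q_add hx
    have h2 := s.norm_sq_le_q ((hdom x).1 hx).1
    linarith
  obtain ⟨a, ha, hfa⟩ := hs f (fun n => ((hdom _).1 (hf n)).1) fun ε hε => by
    obtain ⟨N, hN⟩ := hcau ε hε
    exact ⟨N, fun m hm n hn =>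
      (hle_s _ (u.dom.sub_mem (hf m) (hf n))).trans_lt (hN m hm n hn)⟩
  obtain ⟨b, hb, hfb⟩ := ht f (fun n => ((hdom _).1 (hf n)).2) fun ε hε => by
    obtain ⟨N, hN⟩ := hcau ε hε
    exact ⟨N, fun m hm n hn =>
      (hle_t _ (u.dom.sub_mem (hf m) (hf n))).trans_lt (hN m hm n hn)⟩
  have hab : a = b := tendsto_nhds_unique
    (tendsto_of_tendsto_q (fun n => ((hdom _).1 (hf n)).1) ha hfa)
    (tendsto_of_tendsto_q (fun n => ((hdom _).1 (hf n)).2) hb hfb)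
  subst hab
  have hau : a ∈ u.dom := (hdom a).2 ⟨ha, hb⟩
  refine ⟨a, hau, ?_⟩
  refine squeeze_zero (fun n => u.q_nonneg (u.dom.sub_mem (hf n) hau)) (fun n => ?_)
    (by simpa using hfa.add hfb)
  have h1 := h.q_add (u.dom.sub_mem (hf n) hau)
  nlinarith [sq_nonneg ‖f n - a‖]

theorem IsSum.closable {s t u : PBF H} (h : IsSum s t u) (hs : s.Closable) (ht : t.Closable) :
    u.Closable := by
  obtain ⟨s', hs', hse⟩ := hs
  obtain ⟨t', ht', hte⟩ := ht
  have hle : u.dom ≤ s'.dom ⊓ t'.dom := by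
    rw [h.1]
    exact inf_le_inf hse.1 hte.1
  have hd : Dense ((s'.dom ⊓ t'.dom : Submodule ℂ H) : Set H) := u.dense'.mono hle
  refine ⟨s'.add t' hd, (isSum_add s' t' hd).isClosedForm hs' ht', hle, fun x y hx hy => ?_⟩
  have hx' := h.1 ▸ hx
  have hy' := h.1 ▸ hy
  rw [(isSum_add s' t' hd).2 x y (hle hx) (hle hy), hse.2 x y hx'.1 hy'.1, hte.2 x y hx'.2 hy'.2,
    h.2 x y hx hy]

/-- If a closable form is dominated by `t`, it vanishes in the limit along `t`-Cauchy sequences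
that converge to zero in norm. -/
theorem Closable.tendsto_q_zero {r t : PBF H} (hr : r.Closable) (hd : r.dom = t.dom)
    (hle : ∀ x ∈ t.dom, (r.toFun x x).re ≤ (t.toFun x x).re) {d : ℕ → t.FormSpace}
    (hc : CauchySeq d) (h0 : Tendsto (fun n => t.incl (d n)) atTop (𝓝 0)) :
    Tendsto (fun n => r.q (t.incl (d n))) atTop (𝓝 0) := by
  obtain ⟨s, hs, hse⟩ := hr
  have hmr : ∀ x : t.FormSpace, t.incl x ∈ r.dom := fun x => hd ▸ t.incl_mem x
  have hms : ∀ x : t.FormSpace, t.incl x ∈ s.dom := fun x => hse.1 (hmr x)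
  obtain ⟨y, hy, hlim⟩ := hs (fun n => t.incl (d n)) (fun n => hms _) fun ε hε => by
    obtain ⟨N, hN⟩ := Metric.cauchySeq_iff.mp hc (√ε) (Real.sqrt_pos.mpr hε)
    refine ⟨N, fun m hm n hn => ?_⟩
    have h1 := hN m hm n hn
    rw [dist_eq_norm] at h1
    have h2 : ‖d m - d n‖ ^ 2 < ε := by
      have := pow_lt_pow_left₀ h1 (norm_nonneg _) two_ne_zero
      rwa [Real.sq_sqrt hε.le] at this
    rw [norm_sq_formSpace] at h2
    rw [← map_sub, hse.q_eq (hmr _)]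
    refine lt_of_le_of_lt ?_ h2
    have := hle _ (t.incl_mem (d m - d n))
    rw [q, q]
    linarith
  have hy0 : y = 0 := tendsto_nhds_unique (tendsto_of_tendsto_q (fun n => hms _) hy hlim) h0
  subst hy0
  refine hlim.congr fun n => ?_
  rw [sub_zero, hse.q_eq (hmr _)]

/-- Simon's decomposition: every positive form has a regular part. -/
theorem exists_isRegularPart [CompleteSpace H] (t : PBF H) : ∃ tr : PBF H, t.IsRegularPart tr := by
  let e : t.FormSpace →L[ℂ] UniformSpace.Completion t.FormSpace := UniformSpace.Completion.toComplL
  have he : DenseRange e := UniformSpace.Completion.denseRange_coe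
  have hen : ∀ x, ‖e x‖ = ‖x‖ := fun x => UniformSpace.Completion.norm_coe x
  have hb : ∀ x, ‖t.incl x‖ ≤ 1 * ‖e.toLinearMap x‖ := fun x => by
    rw [one_mul]
    exact (t.norm_incl_le x).trans (hen x).ge
  let J : UniformSpace.Completion t.FormSpace →L[ℂ] H := t.incl.extendOfNorm e.toLinearMap
  have hJe : ∀ x, J (e x) = t.incl x := fun x => LinearMap.extendOfNorm_eq he ⟨1, hb⟩ x
  have hJn : ∀ a, ‖J a‖ ≤ ‖a‖ := fun a => by
    simpa using LinearMap.norm_extendOfNorm_apply_le he 1 hb a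
  let N : Submodule ℂ (UniformSpace.Completion t.FormSpace) := LinearMap.ker J.toLinearMap
  have hNc : IsClosed (N : Set (UniformSpace.Completion t.FormSpace)) := J.isClosed_ker
  have : CompleteSpace N := hNc.completeSpace_coe
  let P : UniformSpace.Completion t.FormSpace →L[ℂ] Nᗮ := Nᗮ.orthogonalProjectionOnto
  have hPN : ∀ a, J (a - (P a : UniformSpace.Completion t.FormSpace)) = 0 := fun a => by
    have h := Submodule.sub_starProjection_mem_orthogonal (K := Nᗮ) a
    rw [Submodule.orthogonal_orthogonal] at h
    exact h
  have hJP : ∀ a, J (P a : UniformSpace.Completion t.FormSpace) = J a := fun a => by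
    have := hPN a
    rw [map_sub, sub_eq_zero] at this
    exact this.symm
  let L : Nᗮ →ₗ[ℂ] H := J.toLinearMap ∘ₗ Nᗮ.subtype
  have hL : Function.Injective L := by
    rw [injective_iff_map_eq_zero]
    intro a ha
    have h1 : (a : UniformSpace.Completion t.FormSpace) ∈ N := ha
    have h2 := Submodule.inner_right_of_mem_orthogonal h1 a.2
    exact Subtype.ext (inner_self_eq_zero.mp h2)
  let A : t.dom →ₗ[ℂ] Nᗮ := P.toLinearMap ∘ₗ e.toLinearMap
  have hLA : ∀ x : t.dom, L (A x) = x := fun x => (hJP (e x)).trans (hJe x)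
  have hLn : ∀ a, ‖L a‖ ≤ ‖a‖ := fun a => hJn a
  have hA : ∀ x : t.dom, ‖(x : H)‖ ≤ ‖A x‖ := fun x => by
    have := hLn (A x)
    rwa [hLA] at this
  let B := (LinearEquiv.ofInjective L hL).symm
  have hLB : ∀ y, L (B y) = y := fun y =>
    congrArg Subtype.val ((LinearEquiv.ofInjective L hL).apply_symm_apply y)
  have hle : t.dom ≤ LinearMap.range L := fun x hx => ⟨A ⟨x, hx⟩, hLA ⟨x, hx⟩⟩
  have hB : ∀ y : LinearMap.range L, ‖(y : H)‖ ≤ ‖B.toLinearMap y‖ := fun y => by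
    have := hLn (B y)
    rwa [hLB] at this
  have hBA : ∀ (x : H) (hx : x ∈ t.dom), B.toLinearMap ⟨x, hle hx⟩ = A ⟨x, hx⟩ := fun x hx =>
    hL ((hLB _).trans (hLA ⟨x, hx⟩).symm)
  have hqt : ∀ x : t.FormSpace, (ofLinear t.dom t.dense' A hA).q (t.incl x) = ‖P (e x)‖ ^ 2 :=
    fun x => q_ofLinear (t.incl_mem x)
  refine ⟨ofLinear t.dom t.dense' A hA, ⟨ofLinear (LinearMap.range L) (t.dense'.mono hle)
    B.toLinearMap hB, isClosedForm_ofLinear B.surjective, hle, fun x y hx hy => ?_⟩,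
    rfl, fun x hx => ?_, fun r hr hd hrt x hx => ?_⟩
  · have hx' : x ∈ t.dom := hx
    have hy' : y ∈ t.dom := hy
    rw [ofLinear_apply (hle hx) (hle hy), ofLinear_apply hx' hy', hBA, hBA]
  · obtain ⟨x', rfl⟩ := t.exists_incl_eq hx
    have h1 := hqt x'
    have h2 : ‖P (e x')‖ ≤ ‖x'‖ := by
      rw [← hen]
      exact Submodule.norm_orthogonalProjectionOnto_apply_le _ _
    have h3 := pow_le_pow_left₀ (norm_nonneg _) h2 2
    rw [← h1, norm_sq_formSpace] at h3
    exact le_of_add_le_add_right h3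
  · have hmr : ∀ x : t.FormSpace, t.incl x ∈ r.dom := fun x => hd ▸ t.incl_mem x
    obtain ⟨x', rfl⟩ := t.exists_incl_eq hx
    let n : UniformSpace.Completion t.FormSpace := e x' - P (e x')
    obtain ⟨s, hs, hsn⟩ := mem_closure_iff_seq_limit.mp (he n)
    choose d hds using hs
    have hdn : Tendsto (fun k => e (d k)) atTop (𝓝 n) := by simpa only [hds] using hsn
    have hcau : CauchySeq d := by
      have := hdn.cauchySeq
      rw [Metric.cauchySeq_iff] at this ⊢
      simpa only [dist_eq_norm, ← map_sub, hen] using this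
    have h0 : Tendsto (fun k => t.incl (d k)) atTop (𝓝 0) := by
      have := (J.continuous.tendsto n).comp hdn
      rw [hPN] at this
      exact this.congr fun k => hJe _
    have hq0 := hr.tendsto_q_zero hd hrt hcau h0
    have hbound : ∀ k, √(r.q (t.incl x')) ≤ ‖e x' - e (d k)‖ + √(r.q (t.incl (d k))) := fun k => by
      have h1 := r.sqrt_q_add_le (hmr (x' - d k)) (hmr (d k))
      rw [← map_add, sub_add_cancel] at h1
      refine h1.trans (add_le_add_left ?_ _)
      rw [← map_sub, hen, norm_formSpace]
      apply Real.sqrt_le_sqrt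
      have := hrt _ (t.incl_mem (x' - d k))
      rw [q, q]
      linarith
    have hlim : Tendsto (fun k => ‖e x' - e (d k)‖ + √(r.q (t.incl (d k)))) atTop
        (𝓝 (‖e x' - n‖ + √0)) :=
      (tendsto_const_nhds.sub hdn).norm.add ((Real.continuous_sqrt.tendsto 0).comp hq0)
    have h4 : √(r.q (t.incl x')) ≤ ‖e x' - n‖ + √0 := ge_of_tendsto' hlim hbound
    have h5 : e x' - n = P (e x') := sub_sub_cancel _ _
    rw [Real.sqrt_zero, add_zero, h5] at h4
    have h6 : r.q (t.incl x') ≤ ‖P (e x')‖ ^ 2 := (Real.sqrt_le_left (norm_nonneg _)).mp h4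
    rw [← hqt x'] at h6
    exact le_of_add_le_add_right h6

theorem Closable.isRegularPart_self {t : PBF H} (ht : t.Closable) : t.IsRegularPart t :=
  ⟨ht, rfl, fun _ _ => le_rfl, fun _ _ _ h => h⟩

/-- The zero form with domain `D`. -/
def zeroOn (D : Submodule ℂ H) (hD : Dense (D : Set H)) : PBF H :=
  ofLinear D hD D.subtype fun _ => le_rfl

theorem zeroOn_apply {D : Submodule ℂ H} {hD : Dense (D : Set H)} (x y : H) :
    (zeroOn D hD).toFun x y = 0 := by
  by_cases h : x ∈ D ∧ y ∈ D
  · exact (ofLinear_apply h.1 h.2).trans (sub_self _)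
  · exact (zeroOn D hD).zero_off x y (by simpa [zeroOn, ofLinear, imp_iff_not_or] using h)

theorem closable_zeroOn [CompleteSpace H] {D : Submodule ℂ H} {hD : Dense (D : Set H)} :
    (zeroOn D hD).Closable := by
  obtain ⟨s, hs, hse⟩ := closable_zeroPBF (H := H)
  exact ⟨s, hs, le_top.trans hse.1, fun x y _ _ =>
    (hse.2 x y trivial trivial).trans (zeroOn_apply x y).symm⟩

theorem Singular.isRegularPart_zeroOn [CompleteSpace H] {t : PBF H} (ht : t.Singular) :
    t.IsRegularPart (zeroOn t.dom t.dense') := by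
  refine ⟨closable_zeroOn, rfl, fun x hx => ?_, fun r hr hd hrt x _ => ?_⟩
  · rw [zeroOn_apply]
    exact t.re_nonneg x hx
  · rw [zeroOn_apply, ht r hr hd hrt]

theorem IsRegularPart.singular {t tr : PBF H} (h : t.IsRegularPart tr)
    (h0 : ∀ x ∈ t.dom, (tr.toFun x x).re = 0) : t.Singular := by
  intro r hr hd hrt
  refine r.toFun_eq_zero_of_diag fun x hx => ?_
  exact le_antisymm ((h.2.2.2 r hr hd hrt x (hd ▸ hx)).trans_eq (h0 x (hd ▸ hx)))
    (r.re_nonneg x hx)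

theorem singular_zeroPBF : (zeroPBF H).Singular := by
  intro r _ hd hrt
  exact r.toFun_eq_zero_of_diag fun x hx =>
    le_antisymm (hrt x (hd ▸ hx)) (r.re_nonneg x hx)

theorem Bounded.eq_zero_of_dense {t : PBF H} (ht : t.Bounded) (hd : t.dom = ⊤)
    {D : Submodule ℂ H} (hD : Dense (D : Set H)) (h0 : ∀ x ∈ D, (t.toFun x x).re = 0) (x : H) :
    (t.toFun x x).re = 0 := by
  obtain ⟨c, hc⟩ := ht
  have hm : ∀ x, x ∈ t.dom := fun x => hd ▸ Submodule.mem_top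
  obtain ⟨d, hdD, hdx⟩ := mem_closure_iff_seq_limit.mp (hD x)
  have key : ∀ n, (t.toFun x x).re ≤ 2 * (c * ‖d n - x‖ ^ 2) := fun n => by
    have hneg : ∀ a b, t.toFun a ((-1 : ℂ) • b) = -t.toFun a b := fun a b => by
      rw [t.smul_right _ _ _ (hm _) (hm _)]; simp
    have hneg' : ∀ a b, t.toFun ((-1 : ℂ) • a) b = -t.toFun a b := fun a b => by
      rw [t.smul_left _ _ _ (hm _) (hm _)]; simp
    have hadd : ∀ a b c, t.toFun (a + b) c = t.toFun a c + t.toFun b c := fun a b c =>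
      t.add_left _ _ _ (hm _) (hm _) (hm _)
    have hadd' : ∀ a b c, t.toFun a (b + c) = t.toFun a b + t.toFun a c := fun a b c =>
      t.add_right _ _ _ (hm _) (hm _) (hm _)
    have h1 := hc (d n - x) (hm _)
    have h2 := t.re_nonneg ((d n + d n) - x) (hm _)
    have h3 := h0 (d n) (hdD n)
    have e : ∀ a b : H, a - b = a + (-1 : ℂ) • b := fun a b => by
      rw [neg_one_smul, sub_eq_add_neg]
    rw [e] at h1 h2
    simp only [hadd, hadd', hneg, hneg', Complex.add_re, Complex.neg_re, h3] at h1 h2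
    rw [← e] at h1
    linarith
  have hlim := (((tendsto_iff_norm_sub_tendsto_zero.mp hdx).pow 2).const_mul c).const_mul 2
  have h1 := ge_of_tendsto' hlim key
  refine le_antisymm (by simpa using h1) (t.re_nonneg x (hm x))

/-- If `s` is not a bounded form on the whole space, its domain is that of the sum `t ⊕ s`. -/
theorem OplusDef.dom_eq_or_bounded {t s u : PBF H} (h : OplusDef t s) (ht : t.InVf) (hs : s.InVf)
    (hu : IsSum t s u) : u.dom = s.dom ∨ s.Bounded ∧ s.dom = ⊤ := by
  rcases h with hb | hb | hd
  · left; rw [hu.1, ht hb, top_inf_eq]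
  · exact Or.inr ⟨hb, hs hb⟩
  · left; rw [hu.1, hd, inf_idem]

end PBF

open PBF

theorem ObarDef.comm {s t : PBF H} (h : ObarDef s t) : ObarDef t s := by
  refine ⟨?_, fun u tr sr ur hu ht hs hur => (h.2 u sr tr ur hu.comm hs ht hur).comm⟩
  rcases h.1 with h | h | h
  · exact Or.inr (Or.inl h)
  · exact Or.inl h
  · exact Or.inr (Or.inr h.symm)

theorem Obar.comm {s t u : PBF H} (h : Obar s t u) : Obar t s u :=
  ⟨ObarDef.comm h.1, IsSum.comm h.2⟩

theorem Obar.closable_right [CompleteSpace H] {t s u : PBF H} (ht : t.InVf) (hs : s.InVf)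
    (htc : t.Closable) (huc : u.Closable) (h : Obar t s u) : s.Closable := by
  rcases h.1.1.dom_eq_or_bounded ht hs h.2 with hd | ⟨hb, hd⟩
  · obtain ⟨sr, hsr⟩ := s.exists_isRegularPart
    have hsum := h.1.2 u t sr u h.2 htc.isRegularPart_self hsr huc.isRegularPart_self
    obtain ⟨s', hs', hse⟩ := hsr.1
    refine ⟨s', hs', hsr.2.1 ▸ hse.1, fun x y hx hy => ?_⟩
    rw [hse.2 x y (hsr.2.1.symm ▸ hx) (hsr.2.1.symm ▸ hy)]
    have h1 := hsum.2 x y (hd.symm ▸ hx) (hd.symm ▸ hy)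
    rw [h.2.2 x y (hd.symm ▸ hx) (hd.symm ▸ hy)] at h1
    exact (add_left_cancel h1).symm
  · exact closable_of_bounded hb hd

theorem Obar.singular [CompleteSpace H] {t s u : PBF H} (ht : t.Singular) (hs : s.Singular)
    (h : Obar t s u) : u.Singular := by
  obtain ⟨ur, hur⟩ := u.exists_isRegularPart
  have hsum := h.1.2 u _ _ ur h.2 ht.isRegularPart_zeroOn hs.isRegularPart_zeroOn hur
  refine hur.singular fun x hx => ?_
  rw [hsum.2 x x (hur.2.1.symm ▸ hx) (hur.2.1.symm ▸ hx), zeroOn_apply, zeroOn_apply]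
  simp

theorem Obar.singular_right [CompleteSpace H] {t s u : PBF H} (ht : t.InVf) (hs : s.InVf)
    (hts : t.Singular) (hus : u.Singular) (h : Obar t s u) : s.Singular := by
  have key : ∀ sr, s.IsRegularPart sr → ∀ x ∈ u.dom, (sr.toFun x x).re = 0 := by
    intro sr hsr x hx
    have hsum := h.1.2 u _ sr _ h.2 hts.isRegularPart_zeroOn hsr hus.isRegularPart_zeroOn
    have h1 := hsum.2 x x hx hx
    rw [zeroOn_apply, zeroOn_apply, zero_add] at h1
    rw [← h1, Complex.zero_re]
  rcases h.1.1.dom_eq_or_bounded ht hs h.2 with hd | ⟨hb, hd⟩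
  · obtain ⟨sr, hsr⟩ := s.exists_isRegularPart
    exact hsr.singular fun x hx => key sr hsr x (hd.symm ▸ hx)
  · have hsr := (closable_of_bounded hb hd).isRegularPart_self
    exact hsr.singular fun x _ => hb.eq_zero_of_dense hd u.dense' (key s hsr) x

/-- `𝓡_f(𝓗)` (closable elements) and `𝓢_f(𝓗)` (singular elements) are
sub-generalized effect algebras of `(𝓥_f(𝓗); ⊕̄, o)`; in particular if `t ⊕̄ s = u` with
`t, u` closable (resp. singular), then `s` is closable (resp. singular). -/
theorem stmt_11 [CompleteSpace H] (h_inf : ¬ FiniteDimensional ℂ H) :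
    SubGEACondBar (fun t : PBF H => t.Closable) ∧
    SubGEACondBar (fun t : PBF H => t.Singular) ∧
    (∀ t u s : PBF H, t.InVf → u.InVf → s.InVf → t.Closable → u.Closable →
      Obar t s u → s.Closable) ∧
    (∀ t u s : PBF H, t.InVf → u.InVf → s.InVf → t.Singular → u.Singular →
      Obar t s u → s.Singular) := by
  refine ⟨⟨closable_zeroPBF, fun x y z hx hy hz h hQ => ?_⟩,
    ⟨singular_zeroPBF, fun x y z hx hy hz h hQ => ?_⟩,
    fun t u s ht _ hs htc huc h => Obar.closable_right ht hs htc huc h,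
    fun t u s ht _ hs hts hus h => Obar.singular_right ht hs hts hus h⟩
  · rcases hQ with ⟨h1, h2⟩ | ⟨h1, h2⟩ | ⟨h1, h2⟩
    · exact ⟨h1, h2, IsSum.closable h.2 h1 h2⟩
    · exact ⟨h1, Obar.closable_right hx hy h1 h2 h, h2⟩
    · exact ⟨Obar.closable_right hy hx h1 h2 (Obar.comm h), h1, h2⟩
  · rcases hQ with ⟨h1, h2⟩ | ⟨h1, h2⟩ | ⟨h1, h2⟩
    · exact ⟨h1, h2, Obar.singular h1 h2 h⟩
    · exact ⟨h1, Obar.singular_right hx hy h1 h2 h, h2⟩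
    · exact ⟨Obar.singular_right hy hx h1 h2 (Obar.comm h), h1, h2⟩
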